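/- arXiv:0710.0171 — 6 statements merged into one kernel-verified Lean document; each statement's English description precedes it below -/
import Mathlib

section
/- For every $\alpha > 0$ and every $r$ with $2M < r \le 8M/3$, one has $H(r) > 0$. -/
/-- The Regge–Wheeler (tortoise) coordinate. -/
noncomputable def rstar (M r : ℝ) : ℝ :=
  r + 2 * M * Real.log (r - 2 * M) - 3 * M - 2 * M * Real.log M

/-- x = r* - α - α^{1/2}. -/
noncomputable def xx (M α r : ℝ) : ℝ := rstar M r - α - Real.sqrt α

/-- f^b = α⁻¹ (arctan(x/α) - arctan(-1 - α^{-1/2})). -/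
noncomputable def fb (M α r : ℝ) : ℝ :=
  α⁻¹ * (Real.arctan (xx M α r / α) - Real.arctan (-1 - (Real.sqrt α)⁻¹))

/-- The constant C_* = 9 α² M³ / (2((α + α^{1/2})² + α²)). -/
noncomputable def Cstar (M α : ℝ) : ℝ :=
  9 * α ^ 2 * M ^ 3 / (2 * ((α + Real.sqrt α) ^ 2 + α ^ 2))

/-- H(r) = M f^b(r) (3r² - 8Mr) - 2 C_* (r - 3M)/α². -/
noncomputable def HH (M α r : ℝ) : ℝ :=
  M * fb M α r * (3 * r ^ 2 - 8 * M * r) - 2 * Cstar M α * (r - 3 * M) / α ^ 2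

/-- The tortoise coordinate is normalised to vanish at `r = 3M`, hence is negative to the left. -/
lemma rstar_neg {M r : ℝ} (hM : 0 < M) (hr1 : 2 * M < r) (hr2 : r < 3 * M) :
    rstar M r < 0 := by
  have hlog : Real.log (r - 2 * M) < Real.log M :=
    Real.log_lt_log (by linarith) (by linarith)
  unfold rstar
  nlinarith

lemma fb_neg {M α r : ℝ} (hα : 0 < α) (h : rstar M r < 0) : fb M α r < 0 := by
  have hs : Real.sqrt α / α = (Real.sqrt α)⁻¹ := Real.sqrt_div_self
  have hx : xx M α r / α < -1 - (Real.sqrt α)⁻¹ := by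
    rw [← hs, div_lt_iff₀ hα, sub_mul, div_mul_cancel₀ _ hα.ne']
    unfold xx
    linarith
  exact mul_neg_of_pos_of_neg (inv_pos.2 hα) (sub_neg.2 (Real.arctan_strictMono hx))

lemma Cstar_pos {M α : ℝ} (hM : 0 < M) (hα : 0 < α) : 0 < Cstar M α := by
  unfold Cstar
  positivity

theorem stmt_5 (M : ℝ) (hM : 0 < M) (α : ℝ) (hα : 0 < α)
    (r : ℝ) (hr1 : 2 * M < r) (hr2 : r ≤ 8 * M / 3) :
    0 < HH M α r := by
  have hr3 : r < 3 * M := by linarith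
  have hf : M * fb M α r ≤ 0 :=
    mul_nonpos_of_nonneg_of_nonpos hM.le (fb_neg hα (rstar_neg hM hr1 hr3)).le
  have hq : 3 * r ^ 2 - 8 * M * r ≤ 0 := by nlinarith
  have hbulk : 0 ≤ M * fb M α r * (3 * r ^ 2 - 8 * M * r) := mul_nonneg_of_nonpos_of_nonpos hf hq
  have hC : 2 * Cstar M α * (r - 3 * M) / α ^ 2 < 0 :=
    div_neg_of_neg_of_pos
      (mul_neg_of_pos_of_neg (mul_pos two_pos (Cstar_pos hM hα)) (sub_neg.2 hr3)) (pow_pos hα 2)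
  unfold HH
  linarith
end

section
/- There exist constants $c > 0$ and $R > 3M$, independent of $\alpha$, and a constant $\alpha_0 > 0$, such that for every $\alpha \ge \alpha_0$ and every $r \ge R$ one has $f^b(r) \ge \frac{c}{\alpha}\,\min\left\{\frac{r}{\alpha},\, 1\right\}$. -/
lemma div_le_arctan_sub_arctan {K x y : ℝ} (hx : -K ≤ x) (hxy : x ≤ y) (hy : y ≤ K) :
    (y - x) / (1 + K ^ 2) ≤ Real.arctan y - Real.arctan x := by
  have h := (convex_Icc (-K) K).mul_sub_le_image_sub_of_le_deriv
    (f := Real.arctan) (C := 1 / (1 + K ^ 2)) Real.continuous_arctan.continuousOn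
    Real.differentiable_arctan.differentiableOn
    (fun z hz ↦ by
      obtain ⟨h₁, h₂⟩ := interior_subset hz
      rw [Real.deriv_arctan]
      exact one_div_le_one_div_of_le (by positivity) (by nlinarith))
    x ⟨hx, hxy.trans hy⟩ y ⟨hx.trans hxy, hy⟩ hxy
  rwa [one_div_mul_eq_div] at h

lemma half_le_rstar {M r : ℝ} (hM : 0 < M) (hr : 6 * M ≤ r) : r / 2 ≤ rstar M r := by
  have hlog : Real.log M ≤ Real.log (r - 2 * M) := Real.log_le_log hM (by linarith)
  unfold rstar
  nlinarith

theorem stmt_6 (M : ℝ) (hM : 0 < M) :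
    ∃ c > (0:ℝ), ∃ R > 3 * M, ∃ α₀ > (0:ℝ), ∀ α ≥ α₀, ∀ r ≥ R,
      fb M α r ≥ c / α * min (r / α) 1 := by
  refine ⟨1 / 10, by norm_num, 6 * M, by linarith, 1, one_pos, fun α hα r hr ↦ ?_⟩
  have hα₀ : 0 < α := by linarith
  have hr₀ : 0 < r := by linarith
  have hinv : (Real.sqrt α)⁻¹ ≤ 1 := inv_le_one_of_one_le₀ (Real.one_le_sqrt.2 hα)
  have hinv₀ : 0 ≤ (Real.sqrt α)⁻¹ := by positivity
  have hx : xx M α r / α = -1 - (Real.sqrt α)⁻¹ + rstar M r / α := by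
    rw [xx, sub_div, sub_div, div_self hα₀.ne', Real.sqrt_div_self']
    ring
  have hs : r / α / 2 ≤ rstar M r / α := by
    rw [div_right_comm]
    exact div_le_div_of_nonneg_right (half_le_rstar hM hr) hα₀.le
  set m := min (r / α) 1 with hm
  have hm₀ : 0 ≤ m := by positivity
  have hmr : m ≤ r / α := min_le_left _ _
  have hm₁ : m ≤ 1 := min_le_right _ _
  have hmono : Real.arctan (-1 - (Real.sqrt α)⁻¹ + m / 2) ≤ Real.arctan (xx M α r / α) :=
    Real.arctan_strictMono.monotone (by rw [hx]; linarith)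
  have hlow := div_le_arctan_sub_arctan (K := 2) (x := -1 - (Real.sqrt α)⁻¹)
    (y := -1 - (Real.sqrt α)⁻¹ + m / 2) (by linarith) (by linarith) (by linarith)
  calc 1 / 10 / α * m = α⁻¹ * (m / 10) := by ring
    _ ≤ fb M α r := mul_le_mul_of_nonneg_left (by linarith) (by positivity)
end

section
/- There exist constants $R > 3M$ and $\alpha_0 > 0$ such that for every $\alpha \ge \alpha_0$ and every $r \ge R$ one has $H(r) > 0$. -/
theorem div_one_add_sq_le_arctan_sub_arctan {a b : ℝ} (hab : a ≤ b) (hb : b ≤ 0) :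
    (b - a) / (1 + a ^ 2) ≤ Real.arctan b - Real.arctan a := by
  have h := (convex_Icc a b).mul_sub_le_image_sub_of_le_deriv (f := Real.arctan)
    (C := 1 / (1 + a ^ 2)) Real.continuous_arctan.continuousOn
    Real.differentiable_arctan.differentiableOn
    (by
      intro x hx
      rw [interior_Icc] at hx
      rw [(Real.hasDerivAt_arctan x).deriv]
      have : x ^ 2 ≤ a ^ 2 := by nlinarith [hx.1, hx.2]
      gcongr)
    a (Set.left_mem_Icc.2 hab) b (Set.right_mem_Icc.2 hab) hab
  rwa [one_div, inv_mul_eq_div] at h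

theorem sub_le_rstar {M r : ℝ} (hM : 0 < M) (hr : 3 * M ≤ r) : r - 3 * M ≤ rstar M r := by
  have h : Real.log M ≤ Real.log (r - 2 * M) := Real.log_le_log hM (by linarith)
  unfold rstar
  nlinarith

theorem Cstar_le {M α : ℝ} (hM : 0 < M) (hα : 0 < α) : Cstar M α ≤ 9 * M ^ 3 / 4 := by
  unfold Cstar
  have h : α ^ 2 ≤ (α + √α) ^ 2 := by
    gcongr
    exact le_add_of_nonneg_right (Real.sqrt_nonneg α)
  rw [div_le_div_iff₀ (by positivity) (by norm_num)]
  nlinarith [mul_le_mul_of_nonneg_left h (pow_pos hM 3).le]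

theorem div_le_fb {M α r : ℝ} (hM : 0 < M) (hα₁ : 1 ≤ α) (hα : M ≤ α) (hr : 4 * M ≤ r) :
    M / (5 * α ^ 2) ≤ fb M α r := by
  have hα₀ : 0 < α := by linarith
  have hs : 1 ≤ √α := Real.one_le_sqrt.2 hα₁
  have hinv : (√α)⁻¹ ≤ 1 := inv_le_one_of_one_le₀ hs
  have hinv₀ : 0 < (√α)⁻¹ := by positivity
  set b := -1 - (√α)⁻¹ with hb
  have hx : xx M α r / α = b + rstar M r / α := by
    have : √α / α = (√α)⁻¹ := Real.sqrt_div_self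
    rw [xx, sub_div, sub_div, this, div_self hα₀.ne', hb]
    ring
  have ht : M / α ≤ rstar M r / α := by
    gcongr
    linarith [sub_le_rstar hM (by linarith : 3 * M ≤ r)]
  have hle : M / α ≤ 1 := (div_le_one hα₀).2 hα
  have hpos : 0 < M / α := by positivity
  have hslope := div_one_add_sq_le_arctan_sub_arctan (a := b) (b := b + M / α)
    (by linarith) (by linarith)
  have hmono : Real.arctan (b + M / α) ≤ Real.arctan (xx M α r / α) := by
    rw [hx]
    exact Real.arctan_mono (by linarith)
  have hfive : M / α / 5 ≤ (b + M / α - b) / (1 + b ^ 2) := by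
    rw [add_sub_cancel_left]
    gcongr
    nlinarith
  calc M / (5 * α ^ 2) = α⁻¹ * (M / α / 5) := by field_simp
    _ ≤ fb M α r := by
      unfold fb
      gcongr
      linarith

theorem stmt_7 (M : ℝ) (hM : 0 < M) :
    ∃ R > 3 * M, ∃ α₀ > (0:ℝ), ∀ α ≥ α₀, ∀ r ≥ R, 0 < HH M α r := by
  refine ⟨11 * M, by linarith, max 1 M, by positivity, fun α hα r hr => ?_⟩
  have hα₁ : 1 ≤ α := (le_max_left _ _).trans hα
  have hαM : M ≤ α := (le_max_right _ _).trans hα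
  have hα₀ : 0 < α := by linarith
  have hq : 25 * M * r ≤ 3 * r ^ 2 - 8 * M * r := by nlinarith
  have hq₀ : 0 < 25 * M * r := by
    have : 0 < r := by linarith
    positivity
  have hfb := div_le_fb hM hα₁ hαM (by linarith : 4 * M ≤ r)
  have hr₃ : 0 ≤ r - 3 * M := by linarith
  have hfirst : M * (M / (5 * α ^ 2)) * (25 * M * r) ≤ M * fb M α r * (3 * r ^ 2 - 8 * M * r) := by
    gcongr
    exact mul_nonneg hM.le ((by positivity : 0 ≤ M / (5 * α ^ 2)).trans hfb)
  have hsecond : 2 * Cstar M α * (r - 3 * M) / α ^ 2 ≤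
      2 * (9 * M ^ 3 / 4) * (r - 3 * M) / α ^ 2 := by
    gcongr
    exact Cstar_le hM hα₀
  have hdiff : M * (M / (5 * α ^ 2)) * (25 * M * r) - 2 * (9 * M ^ 3 / 4) * (r - 3 * M) / α ^ 2 =
      M ^ 3 * (r / 2 + 27 * M / 2) / α ^ 2 := by
    field_simp
    ring
  have hpos : 0 < M ^ 3 * (r / 2 + 27 * M / 2) / α ^ 2 := by
    have : 0 < r := by linarith
    positivity
  unfold HH
  linarith
end

section
/- For every $R > 3M$ there exist constants $c > 0$ and $\alpha_0 > 0$ such that for all $\alpha \ge \alpha_0$ and all $r \in [8M/3, R]$ the second derivative of $H$ satisfies $\frac{d^2 H}{dr^2}(r) \ge c\,\alpha^{-2} > 0$. -/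
theorem hasDerivAt_xx {M α r : ℝ} (hr : 2 * M < r) :
    HasDerivAt (xx M α) (1 + 2 * M / (r - 2 * M)) r := by
  have hs : r - 2 * M ≠ 0 := by linarith
  have h := ((((hasDerivAt_id r).add ((((hasDerivAt_id r).sub_const (2 * M)).log hs).const_mul
    (2 * M))).sub_const (3 * M)).sub_const (2 * M * Real.log M)).sub_const α |>.sub_const (√α)
  refine h.congr_deriv ?_
  simp only [id]
  ring

theorem hasDerivAt_fb {M α r : ℝ} (hα : 0 < α) (hr : 2 * M < r) :
    HasDerivAt (fb M α) ((1 + 2 * M / (r - 2 * M)) / (α ^ 2 + xx M α r ^ 2)) r := by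
  have h := ((((hasDerivAt_xx (α := α) hr).div_const α).arctan).sub_const
    (Real.arctan (-1 - (√α)⁻¹))).const_mul α⁻¹
  refine h.congr_deriv ?_
  have h1 : α ^ 2 + xx M α r ^ 2 ≠ 0 := by positivity
  have h2 : 1 + (xx M α r / α) ^ 2 = (α ^ 2 + xx M α r ^ 2) / α ^ 2 := by
    field_simp
  rw [h2]
  field_simp

theorem hasDerivAt_radial_weight (M r : ℝ) :
    HasDerivAt (fun r : ℝ => 3 * r ^ 2 - 8 * M * r) (6 * r - 8 * M) r := by
  refine (((hasDerivAt_pow 2 r).const_mul 3).sub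
    ((hasDerivAt_id r).const_mul (8 * M))).congr_deriv ?_
  norm_num
  ring

theorem hasDerivAt_HH {M α r : ℝ} (hα : 0 < α) (hr : 2 * M < r) :
    HasDerivAt (HH M α)
      (M * ((1 + 2 * M / (r - 2 * M)) / (α ^ 2 + xx M α r ^ 2)) * (3 * r ^ 2 - 8 * M * r)
        + M * fb M α r * (6 * r - 8 * M) - 2 * Cstar M α / α ^ 2) r := by
  have hL : HasDerivAt (fun r : ℝ => 2 * Cstar M α * (r - 3 * M) / α ^ 2)
      (2 * Cstar M α / α ^ 2) r := by
    refine ((((hasDerivAt_id r).sub_const (3 * M)).const_mul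
      (2 * Cstar M α)).div_const (α ^ 2)).congr_deriv ?_
    ring
  exact (((hasDerivAt_fb hα hr).const_mul M).mul (hasDerivAt_radial_weight M r)).sub hL

theorem deriv_deriv_HH {M α r : ℝ} (hα : 0 < α) (hr : 2 * M < r) :
    deriv (deriv (HH M α)) r =
      M * ((3 * r ^ 2 - 8 * M * r) *
          (-(2 * M / (r - 2 * M) ^ 2) / (α ^ 2 + xx M α r ^ 2)
            - 2 * xx M α r * (1 + 2 * M / (r - 2 * M)) ^ 2 / (α ^ 2 + xx M α r ^ 2) ^ 2)
        + 2 * (6 * r - 8 * M) * ((1 + 2 * M / (r - 2 * M)) / (α ^ 2 + xx M α r ^ 2))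
        + 6 * fb M α r) := by
  have hs : r - 2 * M ≠ 0 := by linarith
  have hD : α ^ 2 + xx M α r ^ 2 ≠ 0 := by positivity
  have heq : deriv (HH M α) =ᶠ[nhds r] fun r =>
      M * ((1 + 2 * M / (r - 2 * M)) / (α ^ 2 + xx M α r ^ 2)) * (3 * r ^ 2 - 8 * M * r)
        + M * fb M α r * (6 * r - 8 * M) - 2 * Cstar M α / α ^ 2 := by
    filter_upwards [lt_mem_nhds hr] with t ht
    exact (hasDerivAt_HH hα ht).deriv
  rw [heq.deriv_eq]
  have hQ : HasDerivAt (fun r : ℝ => 6 * r - 8 * M) 6 r := by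
    refine (((hasDerivAt_id r).const_mul 6).sub_const (8 * M)).congr_deriv ?_
    ring
  have hx' : HasDerivAt (fun r : ℝ => 1 + 2 * M / (r - 2 * M)) (-(2 * M / (r - 2 * M) ^ 2)) r := by
    refine (((hasDerivAt_const r (2 * M)).div ((hasDerivAt_id r).sub_const (2 * M))
      hs).const_add 1).congr_deriv ?_
    simp only [id]
    ring
  have hDen : HasDerivAt (fun r : ℝ => α ^ 2 + xx M α r ^ 2)
      (2 * xx M α r * (1 + 2 * M / (r - 2 * M))) r := by
    refine (((hasDerivAt_xx (α := α) hr).pow 2).const_add (α ^ 2)).congr_deriv ?_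
    norm_num
  have h := ((((hx'.div hDen hD).const_mul M).mul (hasDerivAt_radial_weight M r)).add
    (((hasDerivAt_fb hα hr).const_mul M).mul hQ)).sub_const (2 * Cstar M α / α ^ 2)
  refine (h.congr_deriv ?_).deriv
  simp only [Pi.div_apply]
  generalize 1 + 2 * M / (r - 2 * M) = u
  generalize 2 * M / (r - 2 * M) ^ 2 = v
  generalize xx M α r = x at *
  field_simp
  ring

theorem Real.arctan_sub_arctan_le_half {a b : ℝ} (hba : b ≤ a) (ha : a ≤ -1) :
    Real.arctan a - Real.arctan b ≤ (a - b) / 2 := by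
  have h := Convex.image_sub_le_mul_sub_of_deriv_le (convex_Iic (-1 : ℝ))
    Real.continuous_arctan.continuousOn Real.differentiable_arctan.differentiableOn
    (C := 1 / 2) (fun x hx => ?_) b (hba.trans ha) a ha hba
  · linarith
  · rw [interior_Iic, Set.mem_Iio] at hx
    rw [Real.deriv_arctan]
    exact one_div_le_one_div_of_le (by norm_num) (by nlinarith)

theorem xx_div {M α r : ℝ} (hα : 0 < α) :
    xx M α r / α = -1 - (√α)⁻¹ + rstar M r / α := by
  have h1 : √α / α = (√α)⁻¹ := Real.sqrt_div_self
  rw [← h1, xx]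
  field_simp
  ring

theorem le_fb {M α r : ℝ} (hα : 0 < α) : min (rstar M r) 0 / 2 / α ^ 2 ≤ fb M α r := by
  rw [fb, xx_div hα]
  have hsq : 0 ≤ (√α)⁻¹ := by positivity
  rcases le_total 0 (rstar M r) with h | h
  · rw [min_eq_right h]
    have : Real.arctan (-1 - (√α)⁻¹) ≤ Real.arctan (-1 - (√α)⁻¹ + rstar M r / α) :=
      Real.arctan_mono (le_add_of_nonneg_right (by positivity))
    have h2 := mul_nonneg (inv_pos.2 hα).le (sub_nonneg.2 this)
    simpa using h2
  · rw [min_eq_left h]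
    have h0 : rstar M r / α ≤ 0 := div_nonpos_of_nonpos_of_nonneg h hα.le
    have h1 := Real.arctan_sub_arctan_le_half (a := -1 - (√α)⁻¹)
      (b := -1 - (√α)⁻¹ + rstar M r / α) (by linarith) (by linarith)
    calc rstar M r / 2 / α ^ 2 = α⁻¹ * (rstar M r / α / 2) := by field_simp
      _ ≤ _ := mul_le_mul_of_nonneg_left (by linarith) (by positivity)

theorem rstar_eq {M r : ℝ} (hM : 0 < M) (hr : 2 * M < r) :
    rstar M r = r - 3 * M + 2 * M * Real.log ((r - 2 * M) / M) := by
  rw [rstar, Real.log_div (by linarith) hM.ne']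
  ring

theorem rstar_le {M r : ℝ} (hM : 0 < M) (hr : 2 * M < r) : rstar M r ≤ 3 * (r - 3 * M) := by
  rw [rstar_eq hM hr]
  have h := Real.log_le_sub_one_of_pos (div_pos (sub_pos.2 hr) hM)
  have h2 := mul_le_mul_of_nonneg_left h (by positivity : 0 ≤ 2 * M)
  have h3 : 2 * M * ((r - 2 * M) / M - 1) = 2 * (r - 3 * M) := by field_simp; ring
  linarith

theorem le_rstar {M r : ℝ} (hM : 0 < M) (hr : 8 * M / 3 ≤ r) : -(4 / 3) * M ≤ rstar M r := by
  have hs : 0 < r - 2 * M := by linarith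
  rw [rstar_eq hM (by linarith)]
  have h := Real.one_sub_inv_le_log_of_pos (div_pos hs hM)
  rw [inv_div] at h
  have h2 := mul_le_mul_of_nonneg_left h (by positivity : 0 ≤ 2 * M)
  have h3 : M / (r - 2 * M) ≤ 3 / 2 := by
    rw [div_le_iff₀ hs]; linarith
  have h4 := mul_le_mul_of_nonneg_left h3 (by positivity : 0 ≤ 2 * M)
  linarith

theorem le_radial_coefficient {M r : ℝ} (hM : 0 < M) (hr : 8 * M / 3 ≤ r) :
    26 * M ≤ (3 * r ^ 2 - 8 * M * r) * -(2 * M / (r - 2 * M) ^ 2)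
      + 2 * (6 * r - 8 * M) * (1 + 2 * M / (r - 2 * M)) := by
  obtain ⟨s, rfl⟩ : ∃ s, r = s + 2 * M := ⟨r - 2 * M, by ring⟩
  have hs : 0 < s := by linarith
  rw [add_sub_cancel_right]
  have h : (3 * (s + 2 * M) ^ 2 - 8 * M * (s + 2 * M)) * -(2 * M / s ^ 2)
      + 2 * (6 * (s + 2 * M) - 8 * M) * (1 + 2 * M / s)
      = 26 * M + (12 * s + 8 * M ^ 2 / s + 8 * M ^ 3 / s ^ 2) := by
    field_simp
    ring
  rw [h]
  exact le_add_of_nonneg_right (by positivity)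

theorem stmt_9 (M : ℝ) (hM : 0 < M) (R : ℝ) (hR : 3 * M < R) :
    ∃ c > (0:ℝ), ∃ α₀ > (0:ℝ), ∀ α ≥ α₀, ∀ r ∈ Set.Icc (8 * M / 3) R,
      deriv (deriv (HH M α)) r ≥ c / α ^ 2 ∧ (0:ℝ) < c / α ^ 2 := by
  refine ⟨M ^ 2, by positivity, 3 * R + 4, by linarith, ?_⟩
  rintro α hα r ⟨hr, hrR⟩
  have hα0 : 0 < α := by linarith
  refine ⟨?_, by positivity⟩
  have hr2 : 2 * M < r := by linarith
  have hs : 0 < r - 2 * M := by linarith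
  have hsqrt : √α ≤ α / 2 := Real.sqrt_le_iff.2 ⟨by positivity, by nlinarith⟩
  have hX := le_rstar hM hr
  have hx0 : xx M α r ≤ 0 := by
    have := rstar_le hM hr2
    have := Real.sqrt_nonneg α
    rw [xx]; linarith
  have hx2 : -(2 * α) ≤ xx M α r := by
    rw [xx]; linarith
  have hD : α ^ 2 + xx M α r ^ 2 ≤ 5 * α ^ 2 := by nlinarith
  have hD0 : 0 < α ^ 2 + xx M α r ^ 2 := by positivity
  have hP : 0 ≤ 3 * r ^ 2 - 8 * M * r := by nlinarith
  have hA := le_radial_coefficient hM hr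
  have hf : -(2 / 3) * M / α ^ 2 ≤ fb M α r := by
    refine le_trans ?_ (le_fb hα0)
    gcongr
    have : -(4 / 3) * M ≤ min (rstar M r) 0 := le_min hX (by linarith)
    linarith
  rw [deriv_deriv_HH hα0 hr2]
  generalize fb M α r = f at *
  generalize xx M α r = x at *
  generalize 1 + 2 * M / (r - 2 * M) = u at *
  generalize 2 * M / (r - 2 * M) ^ 2 = v at *
  have hdrop : 0 ≤ (3 * r ^ 2 - 8 * M * r) * (-(2 * x * u ^ 2) / (α ^ 2 + x ^ 2) ^ 2) := by
    refine mul_nonneg hP (div_nonneg ?_ (by positivity))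
    nlinarith [sq_nonneg u]
  have hq : 26 * M / (5 * α ^ 2) ≤ ((3 * r ^ 2 - 8 * M * r) * -v + 2 * (6 * r - 8 * M) * u)
      / (α ^ 2 + x ^ 2) :=
    div_le_div₀ (by linarith) hA hD0 hD
  have hsum : M / α ^ 2 ≤ 26 * M / (5 * α ^ 2) + 6 * (-(2 / 3) * M / α ^ 2) := by
    have : 26 * M / (5 * α ^ 2) + 6 * (-(2 / 3) * M / α ^ 2) = (6 / 5) * (M / α ^ 2) := by
      field_simp
      norm_num
    have : 0 < M / α ^ 2 := by positivity
    linarith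
  calc M ^ 2 / α ^ 2 = M * (M / α ^ 2) := by ring
    _ ≤ M * ((3 * r ^ 2 - 8 * M * r) * (-(2 * x * u ^ 2) / (α ^ 2 + x ^ 2) ^ 2)
        + ((3 * r ^ 2 - 8 * M * r) * -v + 2 * (6 * r - 8 * M) * u) / (α ^ 2 + x ^ 2)
        + 6 * f) := mul_le_mul_of_nonneg_left (by linarith) hM.le
    _ = _ := by ring
end

section
/- There exists a constant $\alpha_0 > 0$ such that for every $\alpha \ge \alpha_0$ one has $H(r) \ge 0$ for all $r > 2M$. -/
/-- On `(-∞, 0]` the graph of `arctan` lies above its tangent line at `-a`, for `0 < a`. -/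
theorem div_one_add_sq_le_arctan_sub_add_arctan {a y : ℝ} (ha : 0 < a) (hy : y ≤ a) :
    y / (1 + a ^ 2) ≤ Real.arctan (y - a) + Real.arctan a := by
  have hd : ∀ u : ℝ, HasDerivAt (fun u => Real.arctan u - u / (1 + a ^ 2))
      (1 / (1 + u ^ 2) - 1 / (1 + a ^ 2)) u := fun u =>
    (Real.hasDerivAt_arctan u).sub ((hasDerivAt_id u).div_const _)
  have hcont : Continuous (fun u => Real.arctan u - u / (1 + a ^ 2)) :=
    continuous_iff_continuousAt.2 fun u => (hd u).continuousAt
  have hmin : Real.arctan (-a) - -a / (1 + a ^ 2) ≤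
      Real.arctan (y - a) - (y - a) / (1 + a ^ 2) := by
    rcases le_total (-a) (y - a) with h | h
    · have hmono : MonotoneOn (fun u => Real.arctan u - u / (1 + a ^ 2)) (Set.Icc (-a) a) := by
        refine monotoneOn_of_deriv_nonneg (convex_Icc _ _) hcont.continuousOn
          (fun u _ => (hd u).differentiableAt.differentiableWithinAt) fun u hu => ?_
        rw [interior_Icc] at hu
        rw [(hd u).deriv, sub_nonneg]
        exact one_div_le_one_div_of_le (by positivity) (by nlinarith [hu.1, hu.2])
      exact hmono ⟨le_rfl, by linarith⟩ ⟨h, by linarith⟩ h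
    · have hanti : AntitoneOn (fun u => Real.arctan u - u / (1 + a ^ 2)) (Set.Iic (-a)) := by
        refine antitoneOn_of_deriv_nonpos (convex_Iic _) hcont.continuousOn
          (fun u _ => (hd u).differentiableAt.differentiableWithinAt) fun u hu => ?_
        rw [interior_Iic, Set.mem_Iio] at hu
        rw [(hd u).deriv, sub_nonpos]
        exact one_div_le_one_div_of_le (by positivity) (by nlinarith)
      exact hanti h (Set.mem_Iic.2 le_rfl) h
  rw [Real.arctan_neg, sub_div, neg_div] at hmin
  linarith

theorem sub_mul_div_le_rstar {M r : ℝ} (hM : 0 < M) (hr : 2 * M < r) :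
    (r - 3 * M) * r / (r - 2 * M) ≤ rstar M r := by
  have hp : 0 < r - 2 * M := by linarith
  have hlog := Real.one_sub_inv_le_log_of_pos (div_pos hp hM)
  rw [Real.log_div hp.ne' hM.ne', inv_div] at hlog
  have heq : (r - 3 * M) * r / (r - 2 * M) = r - 3 * M + 2 * M * (1 - M / (r - 2 * M)) := by
    rw [div_eq_iff hp.ne']
    linear_combination 2 * M * div_mul_cancel₀ M hp.ne'
  rw [heq, rstar]
  nlinarith

theorem sub_three_mul_le_mul_rstar {M r : ℝ} (hM : 0 < M) (hr : 2 * M < r)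
    (h : 0 ≤ 3 * r - 8 * M) :
    9 * M ^ 2 * (r - 3 * M) ≤ r * (3 * r - 8 * M) * rstar M r := by
  have hp : 0 < r - 2 * M := by linarith
  have hr0 : 0 < r := by linarith
  refine le_trans ?_ (mul_le_mul_of_nonneg_left (sub_mul_div_le_rstar hM hr) (by positivity))
  rw [← mul_div_assoc, le_div_iff₀ hp]
  have hq : 0 ≤ 24 * M ^ 2 + 19 * M * (r - 3 * M) + 3 * (r - 3 * M) ^ 2 := by
    nlinarith [sq_nonneg (r - 3 * M)]
  nlinarith [mul_nonneg (sq_nonneg (r - 3 * M)) hq]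

theorem rstar_nonpos {M r : ℝ} (hM : 0 < M) (hr : 2 * M < r) (h : r ≤ 3 * M) :
    rstar M r ≤ 0 := by
  have hlog : Real.log (r - 2 * M) ≤ Real.log M :=
    Real.log_le_log (by linarith) (by linarith)
  unfold rstar
  nlinarith

theorem HH_eq {M α : ℝ} (hα : 0 < α) (r : ℝ) :
    HH M α r = M / (α * (α * (1 + (1 + (√α)⁻¹) ^ 2))) *
      (r * (3 * r - 8 * M) * (α * (1 + (1 + (√α)⁻¹) ^ 2) *
        (Real.arctan (rstar M r / α - (1 + (√α)⁻¹)) + Real.arctan (1 + (√α)⁻¹)))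
        - 9 * M ^ 2 * (r - 3 * M)) := by
  obtain ⟨s, hs, rfl⟩ : ∃ s : ℝ, 0 < s ∧ α = s ^ 2 :=
    ⟨√α, Real.sqrt_pos.2 hα, (Real.sq_sqrt hα.le).symm⟩
  have hx : xx M (s ^ 2) r / s ^ 2 = rstar M r / s ^ 2 - (1 + s⁻¹) := by
    rw [xx, Real.sqrt_sq hs.le]
    field_simp
    ring
  have hneg : -1 - s⁻¹ = -(1 + s⁻¹) := by ring
  have hK : (s ^ 2 + s) ^ 2 + (s ^ 2) ^ 2 = (s ^ 2) ^ 2 * (1 + (1 + s⁻¹) ^ 2) := by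
    field_simp
    ring
  rw [HH, fb, Cstar, hx, Real.sqrt_sq hs.le, hneg, Real.arctan_neg, hK]
  generalize Real.arctan (rstar M r / s ^ 2 - (1 + s⁻¹)) = p
  generalize Real.arctan (1 + s⁻¹) = q
  have hpos : 0 < 1 + (1 + s⁻¹) ^ 2 := by positivity
  generalize 1 + (1 + s⁻¹) ^ 2 = k at hpos
  field_simp
  ring

theorem stmt_10 (M : ℝ) (hM : 0 < M) :
    ∃ α₀ > (0:ℝ), ∀ α ≥ α₀, ∀ r, 2 * M < r → 0 ≤ HH M α r := by
  refine ⟨9 * M, by positivity, fun α hα r hr => ?_⟩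
  have hα0 : 0 < α := by linarith
  have hr0 : 0 < r := by linarith
  rw [HH_eq hα0]
  have ha : 1 ≤ 1 + (√α)⁻¹ := le_add_of_nonneg_right (by positivity)
  generalize 1 + (√α)⁻¹ = a at ha
  have ha0 : 0 < a := by linarith
  refine mul_nonneg (by positivity) (sub_nonneg.2 ?_)
  rcases le_total (3 * r - 8 * M) 0 with h | h
  · have hy : rstar M r / α ≤ 0 :=
      div_nonpos_of_nonpos_of_nonneg (rstar_nonpos hM hr (by linarith)) hα0.le
    have hD : Real.arctan (rstar M r / α - a) + Real.arctan a ≤ 0 := by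
      have := Real.arctan_mono (show rstar M r / α - a ≤ -a by linarith)
      rw [Real.arctan_neg] at this
      linarith
    calc 9 * M ^ 2 * (r - 3 * M) ≤ 0 :=
          mul_nonpos_of_nonneg_of_nonpos (by positivity) (by linarith)
      _ ≤ _ := mul_nonneg_of_nonpos_of_nonpos (mul_nonpos_of_nonneg_of_nonpos hr0.le h)
          (mul_nonpos_of_nonneg_of_nonpos (by positivity) hD)
  · have hc : 0 ≤ r * (3 * r - 8 * M) := mul_nonneg hr0.le h
    rcases le_total (rstar M r / α) a with hy | hy
    · refine (sub_three_mul_le_mul_rstar hM hr h).trans (mul_le_mul_of_nonneg_left ?_ hc)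
      calc rstar M r = α * (1 + a ^ 2) * (rstar M r / α / (1 + a ^ 2)) := by
            field_simp
        _ ≤ _ := mul_le_mul_of_nonneg_left
            (div_one_add_sq_le_arctan_sub_add_arctan ha0 hy) (by positivity)
    · have hr3 : 3 * M < r := by
        by_contra! hle
        have := div_nonpos_of_nonpos_of_nonneg (rstar_nonpos hM hr hle) hα0.le
        linarith
      have hD : a / (1 + a ^ 2) ≤ Real.arctan (rstar M r / α - a) + Real.arctan a :=
        (div_one_add_sq_le_arctan_sub_add_arctan ha0 le_rfl).trans
          (add_le_add_left (Real.arctan_mono (by linarith)) _)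
      calc 9 * M ^ 2 * (r - 3 * M) ≤ r * (3 * r - 8 * M) * (9 * M) := by
            nlinarith [mul_pos hM hM, mul_pos hM (sub_pos.2 hr3),
              mul_pos (mul_pos hM hr0) (sub_pos.2 hr3), pow_pos hM 3]
        _ ≤ r * (3 * r - 8 * M) * (α * (1 + a ^ 2) * (a / (1 + a ^ 2))) := by
            refine mul_le_mul_of_nonneg_left ?_ hc
            have : α * (1 + a ^ 2) * (a / (1 + a ^ 2)) = α * a := by field_simp
            rw [this]
            nlinarith
        _ ≤ _ := mul_le_mul_of_nonneg_left
            (mul_le_mul_of_nonneg_left hD (by positivity)) hc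
end

section
/- There exists a constant $\alpha_0 > 0$ such that for every $\alpha \ge \alpha_0$ and every $x \in [-\alpha, \alpha]$ one has $\frac{(\alpha - x)\,(x + \alpha + \alpha^{1/2})^3}{4\,(x^2 + \alpha^2)^2} < \frac{9}{10}$. -/
theorem stmt_13 :
    ∃ α₀ > (0:ℝ), ∀ α ≥ α₀, ∀ x ∈ Set.Icc (-α) α,
      (α - x) * (x + α + Real.sqrt α) ^ 3 / (4 * (x ^ 2 + α ^ 2) ^ 2) < 9 / 10 := by
  refine ⟨100, by norm_num, fun α hα x ⟨hx₁, hx₂⟩ => ?_⟩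
  have hsqrt : Real.sqrt α ≤ α / 10 := by
    rw [Real.sqrt_le_left (by linarith)]
    nlinarith
  have hsqrt_nonneg := Real.sqrt_nonneg α
  have hpos : 0 < x ^ 2 + α ^ 2 := by nlinarith [sq_nonneg x]
  have hcube : (x + α + Real.sqrt α) ^ 3 ≤ (x + 11 / 10 * α) ^ 3 :=
    pow_le_pow_left₀ (by linarith) (by linarith) 3
  have hmul : (α - x) * (x + 11 / 10 * α) ≤ 6 / 5 * (x ^ 2 + α ^ 2) := by
    nlinarith [sq_nonneg (x + α), sq_nonneg x, sq_nonneg α]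
  have hsq : (x + 11 / 10 * α) ^ 2 ≤ 121 / 50 * (x ^ 2 + α ^ 2) := by
    nlinarith [sq_nonneg (x - α), sq_nonneg x, sq_nonneg α]
  rw [div_lt_iff₀ (by positivity)]
  calc (α - x) * (x + α + Real.sqrt α) ^ 3
      ≤ (α - x) * (x + 11 / 10 * α) ^ 3 :=
        mul_le_mul_of_nonneg_left hcube (by linarith)
    _ = (α - x) * (x + 11 / 10 * α) * (x + 11 / 10 * α) ^ 2 := by ring
    _ ≤ 6 / 5 * (x ^ 2 + α ^ 2) * (121 / 50 * (x ^ 2 + α ^ 2)) :=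
        mul_le_mul hmul hsq (sq_nonneg _) (by positivity)
    _ < 9 / 10 * (4 * (x ^ 2 + α ^ 2) ^ 2) := by nlinarith [pow_pos hpos 2]
end
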